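/- arXiv:2311.07677 — 2 statements merged into one kernel-verified Lean document; each statement's English description precedes it below -/
import Mathlib

section
/- Let A ∈ ℂ^{m×n} be a nonzero matrix, q ≥ 2 a real number, r_1,…,r_m ∈ ℂ^n the conjugate transposes of the m rows of A, v ∈ ℂ^n a right singular vector corresponding to the largest singular value of A (i.e. v ≠ 0 and ‖Av‖_2 = ‖A‖_{2→2}‖v‖_2), and S = {v, r_1, …, r_m}. Then for every real λ > 0: max_{x ∈ S, x ≠ 0} ‖Ax‖_q/‖x‖_2 ≥ min{ λ/2 , λ^{−(q−2)/q} · [ ‖Av‖_q/‖Av‖_2 ]^{2/q} · [ max_{x ∈ S, x ≠ 0} ‖Ax‖_q/(‖x‖_2 ‖A‖_{2→∞}) ]^{(q−2)/q} } · ‖A‖_{2→q}. -/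
open scoped BigOperators

/-- The `ℓ_p` norm of a vector, for a real exponent `p`. -/
noncomputable def lpnorm {n : ℕ} {𝕜 : Type*} [RCLike 𝕜] (p : ℝ) (x : Fin n → 𝕜) : ℝ :=
  (∑ i, ‖x i‖ ^ p) ^ (1 / p)

/-- The `ℓ_∞` norm of a vector. -/
noncomputable def linorm {n : ℕ} {𝕜 : Type*} [RCLike 𝕜] (x : Fin n → 𝕜) : ℝ :=
  ⨆ i, ‖x i‖

/-- The `p → q` operator norm of a matrix: `max_{x ≠ 0} ‖Ax‖_q / ‖x‖_p`. -/
noncomputable def opNorm {m n : ℕ} {𝕜 : Type*} [RCLike 𝕜] (p q : ℝ)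
    (A : Matrix (Fin m) (Fin n) 𝕜) : ℝ :=
  ⨆ x : {x : Fin n → 𝕜 // x ≠ 0}, lpnorm q (A.mulVec x.1) / lpnorm p x.1

/-- The `p → ∞` operator norm of a matrix: `max_{x ≠ 0} ‖Ax‖_∞ / ‖x‖_p`. -/
noncomputable def opNormInf {m n : ℕ} {𝕜 : Type*} [RCLike 𝕜] (p : ℝ)
    (A : Matrix (Fin m) (Fin n) 𝕜) : ℝ :=
  ⨆ x : {x : Fin n → 𝕜 // x ≠ 0}, linorm (A.mulVec x.1) / lpnorm p x.1

/-- `row A i` is the conjugate transpose of the `i`-th row of `A`,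
so that `(A x) i = ⟨x, row A i⟩` for the standard Hermitian inner product. -/
def row {m n : ℕ} {𝕜 : Type*} [RCLike 𝕜] (A : Matrix (Fin m) (Fin n) 𝕜) (i : Fin m) :
    Fin n → 𝕜 := fun k => star (A i k)

/-- The standard Hermitian inner product `⟨x, y⟩ = ∑ k, x k * conj (y k)`. -/
noncomputable def hinner {n : ℕ} (x y : Fin n → ℂ) : ℂ := ∑ k, x k * star (y k)

section LpNorm

variable {m n : ℕ}

lemma lpnorm_nonneg (p : ℝ) (x : Fin n → ℂ) : 0 ≤ lpnorm p x :=
  Real.rpow_nonneg (Finset.sum_nonneg fun _ _ => Real.rpow_nonneg (norm_nonneg _) _) _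

lemma lpnorm_rpow {p : ℝ} (hp : 0 < p) (x : Fin n → ℂ) :
    lpnorm p x ^ p = ∑ i, ‖x i‖ ^ p := by
  rw [lpnorm, ← Real.rpow_mul
    (Finset.sum_nonneg fun _ _ => Real.rpow_nonneg (norm_nonneg _) _),
    one_div_mul_cancel hp.ne', Real.rpow_one]

lemma lpnorm_two_sq (x : Fin n → ℂ) : lpnorm 2 x ^ 2 = ∑ i, ‖x i‖ ^ 2 := by
  exact_mod_cast lpnorm_rpow two_pos x

lemma norm_apply_le_lpnorm {p : ℝ} (hp : 0 < p) (x : Fin n → ℂ) (i : Fin n) :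
    ‖x i‖ ≤ lpnorm p x := by
  rw [← Real.rpow_le_rpow_iff (norm_nonneg _) (lpnorm_nonneg p x) hp, lpnorm_rpow hp]
  exact Finset.single_le_sum (f := fun i => ‖x i‖ ^ p)
    (fun _ _ => Real.rpow_nonneg (norm_nonneg _) _) (Finset.mem_univ i)

lemma lpnorm_pos {p : ℝ} (hp : 0 < p) {x : Fin n → ℂ} (hx : x ≠ 0) : 0 < lpnorm p x := by
  obtain ⟨i, hi⟩ := Function.ne_iff.mp hx
  exact (norm_pos_iff.mpr hi).trans_le (norm_apply_le_lpnorm hp x i)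

lemma lpnorm_zero {p : ℝ} (hp : 0 < p) : lpnorm p (0 : Fin n → ℂ) = 0 := by
  simp [lpnorm, Real.zero_rpow hp.ne', Real.zero_rpow (inv_pos.mpr hp).ne']

lemma lpnorm_smul {p : ℝ} (hp : 0 < p) (c : ℂ) (x : Fin n → ℂ) :
    lpnorm p (c • x) = ‖c‖ * lpnorm p x := by
  rw [← Real.rpow_left_inj (lpnorm_nonneg _ _)
    (mul_nonneg (norm_nonneg _) (lpnorm_nonneg _ _)) hp.ne',
    Real.mul_rpow (norm_nonneg _) (lpnorm_nonneg _ _), lpnorm_rpow hp, lpnorm_rpow hp,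
    Finset.mul_sum]
  simp [Real.mul_rpow]

lemma continuous_lpnorm {p : ℝ} (hp : 0 < p) :
    Continuous (lpnorm p : (Fin n → ℂ) → ℝ) := by
  unfold lpnorm
  refine Continuous.rpow_const ?_ fun _ => Or.inr (by positivity)
  exact continuous_finsetSum _ fun i _ =>
    (continuous_apply i).norm.rpow_const fun _ => Or.inr hp.le

lemma lpnorm_two_eq_norm (x : Fin n → ℂ) : lpnorm 2 x = ‖WithLp.toLp 2 x‖ := by
  rw [← sq_eq_sq₀ (lpnorm_nonneg _ _) (norm_nonneg _), lpnorm_two_sq,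
    EuclideanSpace.norm_sq_eq]

/-- The map `x ↦ ‖Ax‖_p` attains its maximum on the Euclidean unit sphere. -/
lemma exists_maximizer {p : ℝ} (hp : 0 < p) (A : Matrix (Fin m) (Fin n) ℂ)
    {v : Fin n → ℂ} (hv : v ≠ 0) :
    ∃ x : Fin n → ℂ, lpnorm 2 x = 1 ∧
      ∀ z, lpnorm p (A.mulVec z) ≤ lpnorm p (A.mulVec x) * lpnorm 2 z := by
  have normalize : ∀ z : Fin n → ℂ, z ≠ 0 →
      WithLp.toLp 2 (((lpnorm 2 z)⁻¹ : ℂ) • z) ∈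
        Metric.sphere (0 : EuclideanSpace ℂ (Fin n)) 1 := by
    intro z hz
    have h := lpnorm_pos two_pos hz
    rw [mem_sphere_zero_iff_norm, ← lpnorm_two_eq_norm, lpnorm_smul two_pos]
    simp [abs_of_pos h, h.ne']
  have hcont : Continuous fun x : EuclideanSpace ℂ (Fin n) => lpnorm p (A.mulVec x.ofLp) :=
    (continuous_lpnorm hp).comp
      (continuous_const.matrix_mulVec (PiLp.continuous_ofLp 2 _))
  obtain ⟨x, hx, hmax⟩ := (isCompact_sphere (0 : EuclideanSpace ℂ (Fin n)) 1).exists_isMaxOn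
    ⟨_, normalize v hv⟩ hcont.continuousOn
  refine ⟨x.ofLp, ?_, fun z => ?_⟩
  · rw [lpnorm_two_eq_norm]
    exact mem_sphere_zero_iff_norm.mp hx
  rcases eq_or_ne z 0 with rfl | hz
  · simp [lpnorm_zero hp, lpnorm_zero two_pos]
  have h := lpnorm_pos two_pos hz
  have hz' := hmax (normalize z hz)
  simp only [Set.mem_ofPred_eq, Matrix.mulVec_smul, lpnorm_smul hp] at hz'
  rw [norm_inv, Complex.norm_real, Real.norm_of_nonneg h.le, inv_mul_le_iff₀ h] at hz'
  linarith

lemma opNorm_eq_of_maximizer {p : ℝ} {A : Matrix (Fin m) (Fin n) ℂ} {x : Fin n → ℂ}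
    (hx : lpnorm 2 x = 1)
    (hmax : ∀ z, lpnorm p (A.mulVec z) ≤ lpnorm p (A.mulVec x) * lpnorm 2 z) :
    opNorm 2 p A = lpnorm p (A.mulVec x) := by
  have hx0 : x ≠ 0 := by
    rintro rfl
    simp [lpnorm_zero two_pos] at hx
  have : Nonempty {x : Fin n → ℂ // x ≠ 0} := ⟨⟨x, hx0⟩⟩
  have hle : ∀ z : {x : Fin n → ℂ // x ≠ 0},
      lpnorm p (A.mulVec z.1) / lpnorm 2 z.1 ≤ lpnorm p (A.mulVec x) := fun z =>
    (div_le_iff₀ (lpnorm_pos two_pos z.2)).mpr (hmax z.1)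
  refine le_antisymm (ciSup_le hle) ?_
  have := le_ciSup (f := fun z : {x : Fin n → ℂ // x ≠ 0} =>
    lpnorm p (A.mulVec z.1) / lpnorm 2 z.1) ⟨_, Set.forall_mem_range.mpr hle⟩ ⟨x, hx0⟩
  simp only [hx, div_one] at this
  exact this

lemma mulVec_row_self (A : Matrix (Fin m) (Fin n) ℂ) (i : Fin m) :
    A.mulVec (row A i) i = ((lpnorm 2 (row A i) ^ 2 : ℝ) : ℂ) := by
  rw [lpnorm_two_sq]
  simp [Matrix.mulVec, dotProduct, row, Complex.mul_conj']

lemma lpnorm_row_le_opNormInf {A : Matrix (Fin m) (Fin n) ℂ} {v : Fin n → ℂ} (hv : v ≠ 0)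
    (i : Fin m) : lpnorm 2 (row A i) ≤ opNormInf 2 A := by
  obtain ⟨x, -, hmax⟩ := exists_maximizer two_pos A hv
  have hle : ∀ z : {x : Fin n → ℂ // x ≠ 0},
      linorm (A.mulVec z.1) / lpnorm 2 z.1 ≤ lpnorm 2 (A.mulVec x) := fun z =>
    (div_le_iff₀ (lpnorm_pos two_pos z.2)).mpr <|
      (Real.iSup_le (norm_apply_le_lpnorm two_pos _) (lpnorm_nonneg _ _)).trans (hmax z.1)
  rcases eq_or_ne (row A i) 0 with h0 | h0
  · rw [h0, lpnorm_zero two_pos]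
    exact Real.iSup_nonneg fun z => div_nonneg
      (Real.iSup_nonneg fun _ => norm_nonneg _) (lpnorm_nonneg _ _)
  refine le_trans ?_ (le_ciSup (f := fun z : {x : Fin n → ℂ // x ≠ 0} =>
    linorm (A.mulVec z.1) / lpnorm 2 z.1) ⟨_, Set.forall_mem_range.mpr hle⟩ ⟨_, h0⟩)
  rw [le_div_iff₀ (lpnorm_pos two_pos h0), ← sq]
  have h := le_ciSup (f := fun k => ‖A.mulVec (row A i) k‖) (Set.finite_range _).bddAbove i
  rw [mulVec_row_self, Complex.norm_real, Real.norm_of_nonneg (sq_nonneg _)] at h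
  exact h

/-- Hölder's inequality against the dual vector `|y|^{q-2} y` of `y`. -/
lemma norm_sum_mul_dual_le {q : ℝ} (hq : 1 < q) (y b : Fin m → ℂ) :
    ‖∑ k, b k * star (((‖y k‖ ^ (q - 2) : ℝ) : ℂ) * y k)‖ ≤
      lpnorm q b * lpnorm q y ^ (q - 1) := by
  have hpq : q.HolderConjugate q.conjExponent := Real.HolderConjugate.conjExponent hq
  have hw : ∀ k, ‖((‖y k‖ ^ (q - 2) : ℝ) : ℂ) * y k‖ = ‖y k‖ ^ (q - 1) := by
    intro k
    rw [norm_mul, Complex.norm_real, Real.norm_of_nonneg (Real.rpow_nonneg (norm_nonneg _) _)]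
    nth_rewrite 2 [← Real.rpow_one ‖y k‖]
    rw [← Real.rpow_add' (norm_nonneg _) (by linarith)]
    ring_nf
  have h := Real.inner_le_Lp_mul_Lq_of_nonneg Finset.univ hpq
    (f := fun k => ‖b k‖) (g := fun k => ‖y k‖ ^ (q - 1))
    (fun _ _ => norm_nonneg _) (fun _ _ => Real.rpow_nonneg (norm_nonneg _) _)
  refine (norm_sum_le _ _).trans ?_
  simp only [norm_mul (b _), norm_star, hw]
  refine h.trans_eq ?_
  have hexp : (q - 1) * q.conjExponent = q := hpq.sub_one_mul_conj
  simp only [← Real.rpow_mul (norm_nonneg _), hexp]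
  congr 1
  rw [← lpnorm_rpow hpq.pos, ← Real.rpow_mul (lpnorm_nonneg _ _), mul_one_div,
    hpq.div_conj_eq_sub_one]

/-- If `x` maximizes `‖Ax‖_q` on the Euclidean unit sphere, then the stationarity condition
`A*(|Ax|^{q-2} Ax) = ‖Ax‖_q^q x` bounds every entry of `Ax`. -/
lemma lpnorm_mul_norm_apply_le_of_maximizer {q : ℝ} (hq : 2 ≤ q)
    {A : Matrix (Fin m) (Fin n) ℂ} {x : Fin n → ℂ} (hx : lpnorm 2 x = 1)
    (hmax : ∀ z, lpnorm q (A.mulVec z) ≤ lpnorm q (A.mulVec x) * lpnorm 2 z)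
    (hpos : 0 < lpnorm q (A.mulVec x)) (i : Fin m) :
    lpnorm q (A.mulVec x) * ‖A.mulVec x i‖ ≤ lpnorm q (A.mulVec (row A i)) := by
  set y := A.mulVec x with hy
  set N := lpnorm q y with hN
  set w : Fin m → ℂ := fun k => ((‖y k‖ ^ (q - 2) : ℝ) : ℂ) * y k with hw
  set u := A.conjTranspose.mulVec w with hu
  have hNP : N * N ^ (q - 1) = N ^ q := by
    nth_rewrite 1 [← Real.rpow_one N]
    rw [← Real.rpow_add hpos]
    ring_nf
  have hadj : ∀ z, z ⬝ᵥ star u = A.mulVec z ⬝ᵥ star w := by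
    intro z
    rw [hu, Matrix.star_mulVec, Matrix.conjTranspose_conjTranspose, dotProduct_comm,
      ← Matrix.dotProduct_mulVec, dotProduct_comm]
  have hholder : ∀ z, ‖z ⬝ᵥ star u‖ ≤ lpnorm q (A.mulVec z) * N ^ (q - 1) := by
    intro z
    rw [hadj]
    exact norm_sum_mul_dual_le (by linarith) y (A.mulVec z)
  have hxu : x ⬝ᵥ star u = ((N ^ q : ℝ) : ℂ) := by
    rw [hadj, hN, lpnorm_rpow (by linarith), Complex.ofReal_sum]
    refine Finset.sum_congr rfl fun k _ => ?_
    have : ‖y k‖ ^ q = ‖y k‖ ^ (q - 2) * ‖y k‖ ^ 2 := by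
      rw [← Real.rpow_natCast, ← Real.rpow_add' (norm_nonneg _) (by norm_num; linarith)]
      norm_num
    rw [this]
    simp only [hw, Pi.star_apply, star_mul', Complex.star_def, Complex.conj_ofReal, ← hy]
    rw [mul_left_comm, Complex.mul_conj']
    push_cast
    ring
  have huu : u ⬝ᵥ star u = ((lpnorm 2 u ^ 2 : ℝ) : ℂ) := by
    rw [lpnorm_two_sq]
    simp [dotProduct, Complex.mul_conj']
  have hule : lpnorm 2 u ≤ N ^ q := by
    have h := (hholder u).trans
      (mul_le_mul_of_nonneg_right (hmax u) (Real.rpow_nonneg hpos.le _))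
    rw [huu, Complex.norm_real, Real.norm_of_nonneg (sq_nonneg _), mul_right_comm, hNP, sq] at h
    rcases (lpnorm_nonneg 2 u).eq_or_lt with h0 | h0
    · rw [← h0]
      exact Real.rpow_nonneg hpos.le _
    · exact le_of_mul_le_mul_right h h0
  have hsub : ∑ j, ‖u j - ((N ^ q : ℝ) : ℂ) * x j‖ ^ 2 =
      lpnorm 2 u ^ 2 - 2 * N ^ q * N ^ q + (N ^ q) ^ 2 * lpnorm 2 x ^ 2 := by
    have hre : N ^ q = ∑ j, (x j * star (u j)).re := by
      rw [← Complex.re_sum]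
      exact (congrArg Complex.re hxu).symm
    nth_rewrite 3 [hre]
    rw [lpnorm_two_sq, lpnorm_two_sq, Finset.mul_sum, Finset.mul_sum,
      ← Finset.sum_sub_distrib, ← Finset.sum_add_distrib]
    refine Finset.sum_congr rfl fun j _ => ?_
    simp only [← Complex.normSq_eq_norm_sq, Complex.normSq_apply, Complex.sub_re, Complex.sub_im,
      Complex.mul_re, Complex.mul_im, Complex.ofReal_re, Complex.ofReal_im, Complex.star_def,
      Complex.conj_re, Complex.conj_im]
    ring
  have hux : u = ((N ^ q : ℝ) : ℂ) • x := by
    have hle : ∑ j, ‖u j - ((N ^ q : ℝ) : ℂ) * x j‖ ^ 2 ≤ 0 := by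
      rw [hsub, hx]
      nlinarith [lpnorm_nonneg 2 u]
    have hzero := (Finset.sum_eq_zero_iff_of_nonneg fun j _ => sq_nonneg _).mp
      (le_antisymm hle (Finset.sum_nonneg fun j _ => sq_nonneg _))
    ext j
    simpa [sub_eq_zero] using hzero j (Finset.mem_univ j)
  have hrow : star (row A i ⬝ᵥ star u) = ((N ^ q : ℝ) : ℂ) * y i := by
    have : A.mulVec u i = ((N ^ q : ℝ) : ℂ) * y i := by
      rw [hux, Matrix.mulVec_smul]
      rfl
    rw [← this]
    simp [dotProduct, row, Matrix.mulVec]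
  have h := hholder (row A i)
  rw [← norm_star, hrow, norm_mul, Complex.norm_real,
    Real.norm_of_nonneg (Real.rpow_nonneg hpos.le _), ← hNP, mul_right_comm] at h
  exact le_of_mul_le_mul_right h (Real.rpow_pos_of_pos hpos _)

end LpNorm

/-- The final balancing of exponents, with `θ = (q - 2) / q`. -/
lemma rpow_balance {q M N ρ c σ K lam : ℝ} (hq : 2 ≤ q) (hM : 0 < M) (hN : 0 < N) (hρ : 0 < ρ)
    (hc : 0 ≤ c) (hσ : 0 ≤ σ) (hlam : 0 < lam) (hK : 0 ≤ K) (hKM : K ≤ M / ρ)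
    (hpow : N ^ q ≤ (M * ρ / N) ^ (q - 2) * σ ^ 2) (hcσ : c * σ ≤ M) (hlt : M ≤ lam * N) :
    lam ^ (-((q - 2) / q)) * c ^ (2 / q) * K ^ ((q - 2) / q) * N ≤ M := by
  have hq0 : 0 < q := by linarith
  set θ := (q - 2) / q with hθ
  have hθ0 : 0 ≤ θ := div_nonneg (by linarith) hq0.le
  have hNle : N ≤ (M * ρ / N) ^ θ * σ ^ (2 / q) := by
    rw [← Real.rpow_le_rpow_iff hN.le (by positivity) hq0,
      Real.mul_rpow (by positivity) (by positivity), ← Real.rpow_mul (by positivity),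
      ← Real.rpow_mul hσ, hθ, div_mul_cancel₀ _ hq0.ne', div_mul_cancel₀ _ hq0.ne',
      Real.rpow_two]
    exact hpow
  calc lam ^ (-θ) * c ^ (2 / q) * K ^ θ * N
      ≤ lam ^ (-θ) * c ^ (2 / q) * (M / ρ) ^ θ * ((M * ρ / N) ^ θ * σ ^ (2 / q)) := by
        gcongr
    _ = (lam⁻¹ * (M / ρ) * (M * ρ / N)) ^ θ * (c * σ) ^ (2 / q) := by
        rw [Real.mul_rpow (by positivity) (by positivity),
          Real.mul_rpow (by positivity) (by positivity), Real.mul_rpow hc hσ,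
          Real.inv_rpow hlam.le, Real.rpow_neg hlam.le]
        ring
    _ ≤ M ^ θ * M ^ (2 / q) := by
        gcongr
        rw [show lam⁻¹ * (M / ρ) * (M * ρ / N) = M * M / (lam * N) by field_simp,
          div_le_iff₀ (by positivity)]
        gcongr
    _ = M := by
        rw [← Real.rpow_add hM, hθ, ← add_div, sub_add_cancel, div_self hq0.ne', Real.rpow_one]

theorem stmt9 {m n : ℕ} (q : ℝ) (hq : 2 ≤ q) (A : Matrix (Fin m) (Fin n) ℂ) (hA : A ≠ 0)
    (v : Fin n → ℂ) (hv : v ≠ 0)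
    (hsv : lpnorm 2 (A.mulVec v) = opNorm 2 2 A * lpnorm 2 v)
    (M : ℝ)
    (hM : M = sSup {t : ℝ | ∃ x ∈ insert v (Set.range (row A)), x ≠ 0 ∧
      t = lpnorm q (A.mulVec x) / lpnorm 2 x}) :
    ∀ lam : ℝ, 0 < lam →
      M ≥ min (lam / 2)
          (lam ^ (-((q - 2) / q)) *
            (lpnorm q (A.mulVec v) / lpnorm 2 (A.mulVec v)) ^ (2 / q) *
            (sSup {t : ℝ | ∃ x ∈ insert v (Set.range (row A)), x ≠ 0 ∧
                t = lpnorm q (A.mulVec x) / (lpnorm 2 x * opNormInf 2 A)}) ^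
              ((q - 2) / q)) * opNorm 2 q A := by

  intro lam hlam
  have hq0 : 0 < q := by linarith
  obtain ⟨x, hx, hmax⟩ := exists_maximizer hq0 A hv
  obtain ⟨x₂, hx₂, hmax₂⟩ := exists_maximizer two_pos A hv
  rw [opNorm_eq_of_maximizer hx hmax]
  rw [opNorm_eq_of_maximizer hx₂ hmax₂] at hsv
  set S := insert v (Set.range (row A)) with hS
  set ρ := opNormInf 2 A with hρ
  set N := lpnorm q (A.mulVec x) with hN
  set σ := lpnorm 2 (A.mulVec x₂) with hσ
  have hvS : v ∈ S := Set.mem_insert _ _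
  have hrowS : ∀ i, row A i ∈ S := fun i => Set.mem_insert_of_mem _ (Set.mem_range_self i)
  obtain ⟨i₀, j₀, hij⟩ : ∃ i j, A i j ≠ 0 := by
    by_contra! h
    exact hA (Matrix.ext h)
  have hrow₀ : row A i₀ ≠ 0 := fun h => hij (by simpa [row] using congrFun h j₀)
  have hρpos : 0 < ρ := (lpnorm_pos two_pos hrow₀).trans_le (lpnorm_row_le_opNormInf hv i₀)
  have hAe : A.mulVec (row A i₀) ≠ 0 := by
    intro h
    have := congrFun h i₀
    rw [mulVec_row_self, Pi.zero_apply] at this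
    exact (pow_pos (lpnorm_pos two_pos hrow₀) 2).ne' (by exact_mod_cast this)
  have hNpos : 0 < N := pos_of_mul_pos_left
    ((lpnorm_pos hq0 hAe).trans_le (hmax _)) (lpnorm_nonneg _ _)
  have hσpos : 0 < σ := pos_of_mul_pos_left
    ((lpnorm_pos two_pos hAe).trans_le (hmax₂ _)) (lpnorm_nonneg _ _)
  have hvpos := lpnorm_pos two_pos hv
  have hAv : A.mulVec v ≠ 0 := by
    intro h
    rw [h, lpnorm_zero two_pos] at hsv
    exact (mul_pos hσpos hvpos).ne hsv
  have hratio : ∀ z ∈ S, lpnorm q (A.mulVec z) ≤ M * lpnorm 2 z := by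
    intro z hz
    rcases eq_or_ne z 0 with rfl | hz0
    · simp [lpnorm_zero hq0, lpnorm_zero two_pos]
    rw [← div_le_iff₀ (lpnorm_pos two_pos hz0), hM]
    refine le_csSup ⟨N, ?_⟩ ⟨z, hz, hz0, rfl⟩
    rintro _ ⟨z, -, hz0, rfl⟩
    exact (div_le_iff₀ (lpnorm_pos two_pos hz0)).mpr (hmax z)
  have hMpos : 0 < M := pos_of_mul_pos_left
    ((lpnorm_pos hq0 hAv).trans_le (hratio v hvS)) hvpos.le
  have hentry : ∀ i, ‖A.mulVec x i‖ ≤ M * ρ / N := by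
    intro i
    rw [le_div_iff₀' hNpos]
    exact (lpnorm_mul_norm_apply_le_of_maximizer hq hx hmax hNpos i).trans
      ((hratio _ (hrowS i)).trans
        (mul_le_mul_of_nonneg_left (lpnorm_row_le_opNormInf hv i) hMpos.le))
  have hpow : N ^ q ≤ (M * ρ / N) ^ (q - 2) * σ ^ 2 := by
    calc N ^ q = ∑ i, ‖A.mulVec x i‖ ^ (q - 2) * ‖A.mulVec x i‖ ^ 2 := by
          rw [hN, lpnorm_rpow hq0]
          refine Finset.sum_congr rfl fun i _ => ?_
          rw [← Real.rpow_natCast, ← Real.rpow_add' (norm_nonneg _) (by norm_num; linarith)]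
          norm_num
      _ ≤ ∑ i, (M * ρ / N) ^ (q - 2) * ‖A.mulVec x i‖ ^ 2 := by
          gcongr with i
          exact hentry i
      _ = (M * ρ / N) ^ (q - 2) * lpnorm 2 (A.mulVec x) ^ 2 := by
          rw [lpnorm_two_sq, Finset.mul_sum]
      _ ≤ (M * ρ / N) ^ (q - 2) * σ ^ 2 := by
          have := hmax₂ x
          rw [hx, mul_one] at this
          gcongr
          exact lpnorm_nonneg _ _
  have hcσ : lpnorm q (A.mulVec v) / lpnorm 2 (A.mulVec v) * σ ≤ M := by
    rw [hsv, div_mul_eq_mul_div, div_le_iff₀ (mul_pos hσpos hvpos)]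
    nlinarith [hratio v hvS]
  set K := sSup {t : ℝ | ∃ x ∈ S, x ≠ 0 ∧ t = lpnorm q (A.mulVec x) / (lpnorm 2 x * ρ)} with hK
  have hK0 : 0 ≤ K := by
    refine Real.sSup_nonneg ?_
    rintro _ ⟨z, -, -, rfl⟩
    exact div_nonneg (lpnorm_nonneg _ _) (mul_nonneg (lpnorm_nonneg _ _) hρpos.le)
  have hKM : K ≤ M / ρ := by
    refine csSup_le ⟨_, v, hvS, hv, rfl⟩ ?_
    rintro _ ⟨z, hz, hz0, rfl⟩
    rw [← div_div]
    gcongr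
    exact (div_le_iff₀ (lpnorm_pos two_pos hz0)).mpr (hratio z hz)
  rcases le_or_gt (lam / 2 * N) M with h | h
  · exact (mul_le_mul_of_nonneg_right (min_le_left _ _) hNpos.le).trans h
  · refine (mul_le_mul_of_nonneg_right (min_le_right _ _) hNpos.le).trans ?_
    exact rpow_balance hq hMpos hNpos hρpos
      (div_nonneg (lpnorm_nonneg _ _) (lpnorm_nonneg _ _)) hσpos.le hlam hK0 hKM hpow hcσ
      (by nlinarith [mul_pos hlam hNpos])
end

section
/- The maximum of the function f(p,q) = (p−1)(2−p)/p² + (p−1)(q−2)/(p q (q−1)) over the region { (p,q) : 1 ≤ p ≤ 2 ≤ q, 1/p + 1/q ≤ 1 } equals 3 − 2√2, and it is attained at p = √2 and q = √2/(√2 − 1). -/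
/-- The objective function `f(p,q) = (p−1)(2−p)/p² + (p−1)(q−2)/(pq(q−1))`. -/
noncomputable def f13 (p q : ℝ) : ℝ :=
  (p - 1) * (2 - p) / p ^ 2 + (p - 1) * (q - 2) / (p * q * (q - 1))

/-- At the conjugate exponent `q = √2 / (√2 - 1)` of `p = √2`, `f13` equals `3 - 2√2`. -/
theorem f13_sqrt_two :
    f13 (Real.sqrt 2) (Real.sqrt 2 / (Real.sqrt 2 - 1)) = 3 - 2 * Real.sqrt 2 := by
  have hs : Real.sqrt 2 ^ 2 = 2 := Real.sq_sqrt (by norm_num)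
  have hq : Real.sqrt 2 / (Real.sqrt 2 - 1) = 2 + Real.sqrt 2 := by
    have h1 : Real.sqrt 2 - 1 ≠ 0 := fun h => by nlinarith
    rw [div_eq_iff h1]
    linear_combination -hs
  have hpos : 0 < Real.sqrt 2 := by positivity
  have h1 : 2 + Real.sqrt 2 - 1 ≠ 0 := by linarith
  rw [hq, f13]
  generalize Real.sqrt 2 = s at *
  have e1 : (s - 1) * (2 - s) / s ^ 2 = (3 * s - 4) / 2 := by
    rw [hs]
    linear_combination (-1 / 2) * hs
  have e2 : (s - 1) * (2 + s - 2) / (s * (2 + s) * (2 + s - 1)) = (10 - 7 * s) / 2 := by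
    rw [div_eq_iff (by positivity)]
    linear_combination (7 * s ^ 2 + 11 * s) / 2 * hs
  rw [e1, e2]
  ring

/-- The bound `(q - 2) / (q (q - 1)) ≤ 3 - 2√2`, with equality at `q = 2 + √2`. -/
theorem sub_two_div_mul_sub_one_le {q : ℝ} (hq : 1 < q) :
    (q - 2) / (q * (q - 1)) ≤ 3 - 2 * Real.sqrt 2 := by
  have hs : Real.sqrt 2 ^ 2 = 2 := Real.sq_sqrt (by norm_num)
  rw [div_le_iff₀ (mul_pos (by linarith) (by linarith))]
  have h : (3 - 2 * Real.sqrt 2) * (q * (q - 1)) - (q - 2)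
      = ((Real.sqrt 2 - 1) * (q - 2 - Real.sqrt 2)) ^ 2 := by
    generalize Real.sqrt 2 = s at *
    linear_combination (-(q ^ 2) + 2 * q * s - s ^ 2 - 2 * s + 1) * hs
  nlinarith [sq_nonneg ((Real.sqrt 2 - 1) * (q - 2 - Real.sqrt 2))]

theorem f13_le {p q : ℝ} (hp : 1 ≤ p) (hq : 1 < q) : f13 p q ≤ 3 - 2 * Real.sqrt 2 := by
  have hs : Real.sqrt 2 ^ 2 = 2 := Real.sq_sqrt (by norm_num)
  have hp0 : 0 < p := by linarith
  calc f13 p q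
      = (p - 1) * (2 - p) / p ^ 2 + (p - 1) / p * ((q - 2) / (q * (q - 1))) := by
        rw [f13, div_mul_div_comm, mul_assoc p]
    _ ≤ (p - 1) * (2 - p) / p ^ 2 + (p - 1) / p * (3 - 2 * Real.sqrt 2) := by
        have h : 0 ≤ (p - 1) / p := div_nonneg (by linarith) hp0.le
        linarith [mul_le_mul_of_nonneg_left (sub_two_div_mul_sub_one_le hq) h]
    _ = 3 - 2 * Real.sqrt 2 - ((p - Real.sqrt 2) / p) ^ 2 := by
        field_simp
        linear_combination hs
    _ ≤ 3 - 2 * Real.sqrt 2 := sub_le_self _ (sq_nonneg _)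

theorem stmt13 :
    IsGreatest {t : ℝ | ∃ p q : ℝ, 1 ≤ p ∧ p ≤ 2 ∧ 2 ≤ q ∧ 1 / p + 1 / q ≤ 1 ∧
        t = f13 p q} (3 - 2 * Real.sqrt 2) ∧
      f13 (Real.sqrt 2) (Real.sqrt 2 / (Real.sqrt 2 - 1)) = 3 - 2 * Real.sqrt 2 := by
  refine ⟨⟨⟨Real.sqrt 2, Real.sqrt 2 / (Real.sqrt 2 - 1), ?_⟩, ?_⟩, f13_sqrt_two⟩
  · have hs : Real.sqrt 2 ^ 2 = 2 := Real.sq_sqrt (by norm_num)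
    have h1 : 1 < Real.sqrt 2 := Real.lt_sqrt_of_sq_lt (by norm_num)
    have h2 : Real.sqrt 2 ≤ 2 := by nlinarith
    refine ⟨h1.le, h2, ?_, ?_, f13_sqrt_two.symm⟩
    · rw [le_div_iff₀ (by linarith)]
      linarith
    · rw [one_div_div, ← add_div, add_sub_cancel, div_self (by positivity)]
  · rintro t ⟨p, q, hp, -, hq, -, rfl⟩
    exact f13_le hp (by linarith)
end
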